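/- arXiv:2006.05151 — 5 statements merged into one kernel-verified Lean document; each statement's English description precedes it below -/
import Mathlib

section
/- Let A and B be F-algebras, each subject to (A) or (B), and let e : A → B be an F-linear bijection, so that e identifies the projective spaces P(A_F) and P(B_F). Suppose ∥ is a parallelism on the lines of A that is Clifford-like with respect to (P(A_F), ∥ₗ^A, ∥ᵣ^A), and that the transported relation (defined by e(M) ∥' e(N) :⇔ M ∥ N) is Clifford-like with respect to (P(B_F), ∥ₗ^B, ∥ᵣ^B). Then, possibly after interchanging the attributes 'left' and 'right' on B, the double space structures agree under e: for all lines M, N of A, M ∥ₗ^A N ⇔ e(M) ∥ₗ^B e(N) and M ∥ᵣ^A N ⇔ e(M) ∥ᵣ^B e(N), or else M ∥ₗ^A N ⇔ e(M) ∥ᵣ^B e(N) and M ∥ᵣ^A N ⇔ e(M) ∥ₗ^B e(N). -/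
def LeftPar {H : Type*} [Mul H] [Zero H] (S T : Set H) : Prop :=
  ∃ c : H, c ≠ 0 ∧ T = (fun y => c * y) '' S

def RightPar {H : Type*} [Mul H] [Zero H] (S T : Set H) : Prop :=
  ∃ c : H, c ≠ 0 ∧ T = (fun y => y * c) '' S

def GoodAlg (F H : Type*) [Field F] [DivisionRing H] [Algebra F H] : Prop :=
  (∀ z : H, z ∈ Subring.center H ↔ ∃ a : F, z = algebraMap F H a) ∨
      ((∀ x y : H, x * y = y * x) ∧ ∀ h : H, ∃ a : F, h ^ 2 = algebraMap F H a)

section basic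
variable {H : Type*} [DivisionRing H]

theorem LeftPar.symm {S T : Set H} (h : LeftPar S T) : LeftPar T S := by
  obtain ⟨c, hc, rfl⟩ := h
  refine ⟨c⁻¹, inv_ne_zero hc, ?_⟩
  rw [Set.image_image]
  simp [inv_mul_cancel_left₀ hc]

theorem RightPar.symm {S T : Set H} (h : RightPar S T) : RightPar T S := by
  obtain ⟨c, hc, rfl⟩ := h
  refine ⟨c⁻¹, inv_ne_zero hc, ?_⟩
  rw [Set.image_image]
  simp [mul_inv_cancel_right₀ hc]

theorem LeftPar.trans {S T U : Set H} (h : LeftPar S T) (h' : LeftPar T U) : LeftPar S U := by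
  obtain ⟨c, hc, rfl⟩ := h
  obtain ⟨d, hd, rfl⟩ := h'
  exact ⟨d * c, mul_ne_zero hd hc, by rw [Set.image_image]; simp [mul_assoc]⟩

theorem RightPar.trans {S T U : Set H} (h : RightPar S T) (h' : RightPar T U) : RightPar S U := by
  obtain ⟨c, hc, rfl⟩ := h
  obtain ⟨d, hd, rfl⟩ := h'
  exact ⟨c * d, mul_ne_zero hc hd, by rw [Set.image_image]; simp [mul_assoc]⟩

theorem LeftPar.smul {S T : Set H} {u : H} (hu : u ≠ 0) (h : LeftPar S T) :
    LeftPar ((fun y => u * y) '' S) ((fun y => u * y) '' T) := by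
  obtain ⟨c, hc, rfl⟩ := h
  refine ⟨u * c * u⁻¹, mul_ne_zero (mul_ne_zero hu hc) (inv_ne_zero hu), ?_⟩
  simp only [Set.image_image]
  refine Set.image_congr fun y _ => ?_
  simp [mul_assoc, inv_mul_cancel_left₀ hu]

theorem RightPar.smul {S T : Set H} {u : H} (h : RightPar S T) :
    RightPar ((fun y => u * y) '' S) ((fun y => u * y) '' T) := by
  obtain ⟨c, hc, rfl⟩ := h
  refine ⟨c, hc, ?_⟩
  simp only [Set.image_image]
  refine Set.image_congr fun y _ => ?_
  simp [mul_assoc]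

theorem leftPar_smul_iff {S T : Set H} {u : H} (hu : u ≠ 0) :
    LeftPar ((fun y => u * y) '' S) ((fun y => u * y) '' T) ↔ LeftPar S T := by
  refine ⟨fun h => ?_, LeftPar.smul hu⟩
  have := h.smul (inv_ne_zero hu)
  simpa [Set.image_image, inv_mul_cancel_left₀ hu] using this

theorem rightPar_smul_iff {S T : Set H} {u : H} (hu : u ≠ 0) :
    RightPar ((fun y => u * y) '' S) ((fun y => u * y) '' T) ↔ RightPar S T := by
  refine ⟨fun h => ?_, RightPar.smul⟩
  have := h.smul (u := u⁻¹)
  simpa [Set.image_image, inv_mul_cancel_left₀ hu] using this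

/-- An additive map preserving all right `K`-lines is a homothety. -/
theorem key_left (K : AddSubgroup H) (hmul : ∀ x ∈ K, ∀ y ∈ K, x * y ∈ K)
    (hinv : ∀ x ∈ K, x⁻¹ ∈ K) (hone : (1 : H) ∈ K) (hne : ∃ z, z ∉ K) (b : H) (hb : b ∈ K)
    (φ : H → H) (hadd : ∀ x y, φ (x + y) = φ x + φ y)
    (h : ∀ x, x ≠ 0 → ∃ k ∈ K, φ x = x * k) (h1 : φ 1 = b) (x : H) : φ x = x * b := by
  have main : ∀ x, x ∉ K → φ x = x * b := by
    intro x hx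
    have hx0 : x ≠ 0 := fun h => hx (h ▸ K.zero_mem)
    have hx1 : 1 + x ≠ 0 := by
      intro h0
      apply hx
      have : x = -1 := by rw [eq_neg_iff_add_eq_zero, add_comm]; exact h0
      rw [this]; exact K.neg_mem hone
    obtain ⟨l, hl, hl'⟩ := h x hx0
    obtain ⟨m, hm, hm'⟩ := h (1 + x) hx1
    rw [hadd, h1, hl', add_mul, one_mul] at hm'
    have e1 : x * (l - m) = m - b := by
      rw [mul_sub, sub_eq_sub_iff_add_eq_add, add_comm, hm']
    by_cases hlm : l - m = 0
    · rw [hlm, mul_zero] at e1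
      rw [hl', sub_eq_zero.1 hlm, sub_eq_zero.1 e1.symm]
    · exfalso
      apply hx
      rw [(eq_mul_inv_iff_mul_eq₀ hlm).2 e1]
      exact hmul _ (K.sub_mem hm hb) _ (hinv _ (K.sub_mem hl hm))
  by_cases hx : x ∈ K
  · obtain ⟨z, hz⟩ := hne
    have h2 : z + x ∉ K := fun h => hz ((K.add_mem_cancel_right hx).1 h)
    have := main _ h2
    rw [hadd, main _ hz, add_mul] at this
    exact add_left_cancel this
  · exact main x hx
/-- An additive map preserving all left `K`-lines is a homothety. -/
theorem key_right (K : AddSubgroup H) (hmul : ∀ x ∈ K, ∀ y ∈ K, x * y ∈ K)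
    (hinv : ∀ x ∈ K, x⁻¹ ∈ K) (hone : (1 : H) ∈ K) (hne : ∃ z, z ∉ K) (b : H) (hb : b ∈ K)
    (φ : H → H) (hadd : ∀ x y, φ (x + y) = φ x + φ y)
    (h : ∀ x, x ≠ 0 → ∃ k ∈ K, φ x = k * x) (h1 : φ 1 = b) (x : H) : φ x = b * x := by
  have main : ∀ x, x ∉ K → φ x = b * x := by
    intro x hx
    have hx0 : x ≠ 0 := fun h => hx (h ▸ K.zero_mem)
    have hx1 : 1 + x ≠ 0 := by
      intro h0
      apply hx
      have : x = -1 := by rw [eq_neg_iff_add_eq_zero, add_comm]; exact h0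
      rw [this]; exact K.neg_mem hone
    obtain ⟨l, hl, hl'⟩ := h x hx0
    obtain ⟨m, hm, hm'⟩ := h (1 + x) hx1
    rw [hadd, h1, hl', mul_add, mul_one] at hm'
    have e1 : (l - m) * x = m - b := by
      rw [sub_mul, sub_eq_sub_iff_add_eq_add, add_comm, hm']
    by_cases hlm : l - m = 0
    · rw [hlm, zero_mul] at e1
      rw [hl', sub_eq_zero.1 hlm, sub_eq_zero.1 e1.symm]
    · exfalso
      apply hx
      rw [(eq_inv_mul_iff_mul_eq₀ hlm).2 e1]
      exact hmul _ (hinv _ (K.sub_mem hl hm)) _ (K.sub_mem hm hb)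
  by_cases hx : x ∈ K
  · obtain ⟨z, hz⟩ := hne
    have h2 : z + x ∉ K := fun h => hz ((K.add_mem_cancel_right hx).1 h)
    have := main _ h2
    rw [hadd, main _ hz, mul_add] at this
    exact add_left_cancel this
  · exact main x hx
end basic

section alg
variable {F H : Type*} [Field F] [DivisionRing H] [Algebra F H]

theorem linInd_one {b : H} (hb : ∀ a : F, b ≠ algebraMap F H a) :
    LinearIndependent F ![(1 : H), b] := by
  rw [LinearIndependent.pair_iff' one_ne_zero]
  intro a h
  exact hb a (by rw [← h, Algebra.algebraMap_eq_smul_one])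

theorem finrank_pair {b : H} (hb : ∀ a : F, b ≠ algebraMap F H a) :
    Module.finrank F (Submodule.span F {(1 : H), b}) = 2 := by
  have := finrank_span_eq_card (linInd_one hb)
  have hr : Set.range ![(1 : H), b] = {1, b} := Matrix.range_cons_cons_empty _ _ _
  rw [hr] at this
  exact this.trans (Fintype.card_fin 2)

/-- The span of `1, b` is a subring closed under inverses. -/
theorem span_pair_closed (hrank : Module.finrank F H = 4) (hH : GoodAlg F H) {b : H}
    (hb : ∀ a : F, b ≠ algebraMap F H a) :
    (∀ x ∈ Submodule.span F {(1 : H), b}, ∀ y ∈ Submodule.span F {(1 : H), b},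
      x * y ∈ Submodule.span F {(1 : H), b}) ∧
    (∀ x ∈ Submodule.span F {(1 : H), b}, x⁻¹ ∈ Submodule.span F {(1 : H), b}) := by
  have hfd : FiniteDimensional F H := FiniteDimensional.of_finrank_pos (by omega)
  rcases hH with hc | ⟨hcomm, hsq⟩
  · have hfr := finrank_pair hb
    set C := Subalgebra.centralizer F ({b} : Set H) with hC
    have hle : Submodule.span F {(1 : H), b} ≤ Subalgebra.toSubmodule C := by
      rw [Submodule.span_le]
      rintro x (rfl | rfl)
      · exact C.one_mem
      · exact Subalgebra.mem_centralizer_iff F |>.2 (by simp)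
    have hinv : ∀ x ∈ C, x⁻¹ ∈ C := by
      intro x hx
      simp only [hC, Subalgebra.mem_centralizer_iff, Set.mem_singleton_iff, forall_eq] at hx ⊢
      exact (Commute.inv_right₀ (show Commute b x from hx)).eq
    obtain ⟨x, hx⟩ : ∃ x, x ∉ C := by
      by_contra! hall
      obtain ⟨a, ha⟩ := (hc b).1 (by
        rw [Subring.mem_center_iff]
        intro g
        have := hall g
        simp only [hC, Subalgebra.mem_centralizer_iff, Set.mem_singleton_iff, forall_eq] at this
        exact this.symm)
      exact hb a ha
    have hx0 : x ≠ 0 := fun h => hx (h ▸ C.zero_mem)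
    set D := (Subalgebra.toSubmodule C).map (LinearMap.mulLeft F x) with hD
    have hDr : Module.finrank F D = Module.finrank F (Subalgebra.toSubmodule C) :=
      (Submodule.equivMapOfInjective (LinearMap.mulLeft F x) (mul_right_injective₀ hx0) _).finrank_eq.symm
    have hdisj : Disjoint (Subalgebra.toSubmodule C) D := by
      rw [Submodule.disjoint_def]
      rintro _ hy ⟨c, hcC, rfl⟩
      by_contra h0
      have hc0 : c ≠ 0 := by rintro rfl; simp at h0
      apply hx
      have := C.mul_mem hy (hinv _ hcC)
      simpa [mul_assoc, hc0] using this
    have h4 := Submodule.finrank_add_finrank_le_of_disjoint hdisj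
    have heq : Submodule.span F {(1 : H), b} = Subalgebra.toSubmodule C :=
      Submodule.eq_of_le_of_finrank_le hle (by omega)
    rw [heq]
    exact ⟨fun x hx y hy => C.mul_mem hx hy, hinv⟩
  · obtain ⟨q, hq⟩ := hsq b
    refine ⟨?_, ?_⟩
    · intro x hx y hy
      rw [Submodule.mem_span_pair] at *
      obtain ⟨s, t, rfl⟩ := hx
      obtain ⟨s', t', rfl⟩ := hy
      refine ⟨s * s' + t * t' * q, s * t' + t * s', ?_⟩
      have : b * b = q • (1 : H) := by rw [← sq, hq, Algebra.algebraMap_eq_smul_one]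
      simp only [add_mul, mul_add, smul_mul_smul_comm, one_mul, mul_one, this, add_smul, smul_smul]
      abel
    · intro x hx
      obtain ⟨r, hr⟩ := hsq x
      by_cases hx0 : x = 0
      · simp [hx0]
      have : x⁻¹ = r⁻¹ • x := by
        have hr0 : r ≠ 0 := by
          rintro rfl
          simp [hx0] at hr
        rw [inv_eq_iff_eq_inv]
        apply eq_inv_of_mul_eq_one_left
        rw [mul_smul_comm, ← sq, hr, Algebra.algebraMap_eq_smul_one, smul_smul,
          inv_mul_cancel₀ hr0, one_smul]
      rw [this]
      exact Submodule.smul_mem _ _ hx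

theorem infinite_of_good (hrank : Module.finrank F H = 4) (hH : GoodAlg F H) : Infinite F := by
  have hfd : FiniteDimensional F H := FiniteDimensional.of_finrank_pos (by omega)
  by_contra hinf
  have hF : Finite F := not_infinite_iff_finite.1 hinf
  have hHf : Finite H := Module.finite_of_finite F
  have hall : ∀ b : H, ∃ a : F, b = algebraMap F H a := by
    rcases hH with hc | ⟨hcomm, hsq⟩
    · intro b
      rw [← hc b, Subring.mem_center_iff]
      intro g
      letI := littleWedderburn H
      exact mul_comm g b
    · intro b
      by_cases h2 : (2 : H) = 0
      · have hinj : Function.Injective (fun x : H => x ^ 2) := by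
          intro x y hxy
          have h3 : (x - y) ^ 2 = 0 := by
            have : (x - y) ^ 2 = x ^ 2 + y ^ 2 - 2 * (x * y) := by
              rw [sq, sub_mul, mul_sub, mul_sub, hcomm y x, two_mul, sq, sq]; abel
            rw [this, h2]
            simp only at hxy
            rw [hxy, ← two_mul, h2]; simp
          exact sub_eq_zero.1 (pow_eq_zero_iff two_ne_zero |>.1 h3)
        obtain ⟨c, rfl⟩ := Finite.surjective_of_injective hinj b
        exact hsq c
      · obtain ⟨p, hp⟩ := hsq b
        obtain ⟨q, hq⟩ := hsq (b + 1)
        refine ⟨(q - p - 1) / 2, ?_⟩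
        rw [map_div₀, map_sub, map_sub, ← hp, ← hq, map_one, map_ofNat, eq_div_iff h2]
        rw [sq, sq, add_mul, mul_add, mul_two]; simp only [mul_one, one_mul]; abel
  have htop : Submodule.span F {(1 : H)} = ⊤ := by
    rw [eq_top_iff]
    intro b _
    obtain ⟨a, rfl⟩ := hall b
    rw [Submodule.mem_span_singleton]
    exact ⟨a, (Algebra.algebraMap_eq_smul_one a).symm⟩
  have := finrank_span_singleton (K := F) (one_ne_zero (α := H))
  rw [htop, finrank_top] at this
  omega

/-- a left parallel line to a subfield through `x` -/
theorem eq_mul_of_left {K T : Set H} (hmul : ∀ x ∈ K, ∀ y ∈ K, x * y ∈ K)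
    (hinv : ∀ x ∈ K, x⁻¹ ∈ K) (h : LeftPar K T) {x : H} (hx0 : x ≠ 0) (hx : x ∈ T) (y : H) :
    y ∈ T ↔ ∃ k ∈ K, y = x * k := by
  obtain ⟨c, hc, rfl⟩ := h
  obtain ⟨l, hl, rfl⟩ := hx
  have hl0 : l ≠ 0 := by rintro rfl; simp at hx0
  constructor
  · rintro ⟨m, hm, rfl⟩
    exact ⟨l⁻¹ * m, hmul _ (hinv _ hl) _ hm, by simp [mul_assoc, mul_inv_cancel_left₀ hl0]⟩
  · rintro ⟨k, hk, rfl⟩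
    exact ⟨l * k, hmul _ hl _ hk, by simp [mul_assoc]⟩

theorem eq_mul_of_right {K T : Set H} (hmul : ∀ x ∈ K, ∀ y ∈ K, x * y ∈ K)
    (hinv : ∀ x ∈ K, x⁻¹ ∈ K) (h : RightPar K T) {x : H} (hx0 : x ≠ 0) (hx : x ∈ T) (y : H) :
    y ∈ T ↔ ∃ k ∈ K, y = k * x := by
  obtain ⟨c, hc, rfl⟩ := h
  obtain ⟨l, hl, rfl⟩ := hx
  have hl0 : l ≠ 0 := by rintro rfl; simp at hx0
  constructor
  · rintro ⟨m, hm, rfl⟩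
    exact ⟨m * l⁻¹, hmul _ hm _ (hinv _ hl), by simp [← mul_assoc, inv_mul_cancel_right₀ hl0]⟩
  · rintro ⟨k, hk, rfl⟩
    exact ⟨k * l, hmul _ hk _ hl, by simp [mul_assoc]⟩

end alg

section core
variable {F A B : Type*} [Field F] [DivisionRing A] [Algebra F A] [DivisionRing B] [Algebra F B]

theorem mult_par (e : A ≃ₗ[F] B) (hm : ∀ x y, e (x * y) = e x * e y) (S T : Set A) :
    (LeftPar S T ↔ LeftPar (e '' S) (e '' T)) ∧ (RightPar S T ↔ RightPar (e '' S) (e '' T)) := by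
  refine ⟨⟨?_, ?_⟩, ⟨?_, ?_⟩⟩
  · rintro ⟨c, hc, rfl⟩
    exact ⟨e c, by simpa using hc, by simp only [Set.image_image, hm]⟩
  · rintro ⟨d, hd, h⟩
    obtain ⟨c, rfl⟩ := e.surjective d
    refine ⟨c, by simpa using hd, e.injective.image_injective ?_⟩
    rw [h]; simp only [Set.image_image, hm]
  · rintro ⟨c, hc, rfl⟩
    exact ⟨e c, by simpa using hc, by simp only [Set.image_image, hm]⟩
  · rintro ⟨d, hd, h⟩
    obtain ⟨c, rfl⟩ := e.surjective d
    refine ⟨c, by simpa using hd, e.injective.image_injective ?_⟩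
    rw [h]; simp only [Set.image_image, hm]

theorem anti_par (e : A ≃ₗ[F] B) (hm : ∀ x y, e (x * y) = e y * e x) (S T : Set A) :
    (LeftPar S T ↔ RightPar (e '' S) (e '' T)) ∧ (RightPar S T ↔ LeftPar (e '' S) (e '' T)) := by
  refine ⟨⟨?_, ?_⟩, ⟨?_, ?_⟩⟩
  · rintro ⟨c, hc, rfl⟩
    exact ⟨e c, by simpa using hc, by simp only [Set.image_image, hm]⟩
  · rintro ⟨d, hd, h⟩
    obtain ⟨c, rfl⟩ := e.surjective d
    refine ⟨c, by simpa using hd, e.injective.image_injective ?_⟩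
    rw [h]; simp only [Set.image_image, hm]
  · rintro ⟨c, hc, rfl⟩
    exact ⟨e c, by simpa using hc, by simp only [Set.image_image, hm]⟩
  · rintro ⟨d, hd, h⟩
    obtain ⟨c, rfl⟩ := e.surjective d
    refine ⟨c, by simpa using hd, e.injective.image_injective ?_⟩
    rw [h]; simp only [Set.image_image, hm]

/-- The four ways in which multiplication by `a` can be compatible with `e`. -/
def subLL (e : A ≃ₗ[F] B) : Submodule F A where
  carrier := {a | ∀ x, e (x * a) = e x * e a}
  zero_mem' := by simp
  add_mem' := by intro a b ha hb x; simp [mul_add, ha x, hb x]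
  smul_mem' := by intro c a ha x; simp [ha x]

def subLR (e : A ≃ₗ[F] B) : Submodule F A where
  carrier := {a | ∀ x, e (x * a) = e a * e x}
  zero_mem' := by simp
  add_mem' := by intro a b ha hb x; simp [mul_add, add_mul, ha x, hb x]
  smul_mem' := by intro c a ha x; simp [ha x]

def subRL (e : A ≃ₗ[F] B) : Submodule F A where
  carrier := {a | ∀ x, e (a * x) = e x * e a}
  zero_mem' := by simp
  add_mem' := by intro a b ha hb x; simp [mul_add, add_mul, ha x, hb x]
  smul_mem' := by intro c a ha x; simp [ha x]

def subRR (e : A ≃ₗ[F] B) : Submodule F A where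
  carrier := {a | ∀ x, e (a * x) = e a * e x}
  zero_mem' := by simp
  add_mem' := by intro a b ha hb x; simp [add_mul, ha x, hb x]
  smul_mem' := by intro c a ha x; simp [ha x]

theorem core (hrankA : Module.finrank F A = 4) (hA : GoodAlg F A)
    (hrankB : Module.finrank F B = 4) (hB : GoodAlg F B)
    (e : A ≃ₗ[F] B) (he1 : e 1 = 1)
    (P : Submodule F A → Submodule F A → Prop)
    (hsymm : ∀ M N, P M N → P N M)
    (htrans : ∀ M N K, P M N → P N K → P M K)
    (hpar : ∀ x : A, x ≠ 0 → ∀ M : Submodule F A, Module.finrank F M = 2 →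
      ∃ N : Submodule F A, x ∈ N ∧ P N M)
    (hCLA : ∀ M N : Submodule F A, P M N →
      LeftPar (M : Set A) (N : Set A) ∨ RightPar (M : Set A) (N : Set A))
    (hCLB : ∀ M N : Submodule F A, P M N →
      LeftPar (e '' (M : Set A)) (e '' (N : Set A)) ∨
      RightPar (e '' (M : Set A)) (e '' (N : Set A))) :
    (∀ x y, e (x * y) = e x * e y) ∨ (∀ x y, e (x * y) = e y * e x) := by
  have hinf : Infinite F := infinite_of_good hrankA hA
  have hfdB : FiniteDimensional F B := FiniteDimensional.of_finrank_pos (by omega)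
  have hcase : ∀ a : A, a ∈ subLL e ∨ a ∈ subLR e ∨ a ∈ subRL e ∨ a ∈ subRR e := by
    intro a
    by_cases hsc : ∃ q : F, a = algebraMap F A q
    · obtain ⟨q, rfl⟩ := hsc
      left
      intro x
      simp [Algebra.algebraMap_eq_smul_one, he1]
    push Not at hsc
    set L := Submodule.span F {(1 : A), a} with hL
    have hLr : Module.finrank F L = 2 := finrank_pair hsc
    obtain ⟨hLm, hLi⟩ := span_pair_closed hrankA hA hsc
    have hscB : ∀ q : F, e a ≠ algebraMap F B q := by
      intro q hq
      apply hsc q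
      apply e.injective
      rw [hq, Algebra.algebraMap_eq_smul_one, Algebra.algebraMap_eq_smul_one, map_smul, he1]
    set K := Submodule.span F {(1 : B), e a} with hK
    have hKr : Module.finrank F K = 2 := finrank_pair hscB
    obtain ⟨hKm, hKi⟩ := span_pair_closed hrankB hB hscB
    have hLK : e '' (L : Set A) = (K : Set B) := by
      have : L.map (e : A →ₗ[F] B) = K := by
        rw [hL, Submodule.map_span, Set.image_pair]
        simp [hK, he1]
      rw [← this]; rfl
    have hKne : ∃ z, z ∉ K.toAddSubgroup := by
      by_contra! hall
      have : K = ⊤ := by rw [eq_top_iff]; exact fun z _ => hall z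
      rw [this, finrank_top] at hKr
      omega
    have h1K : (1 : B) ∈ K := Submodule.subset_span (by simp)
    have haK : e a ∈ K := Submodule.subset_span (by simp)
    have haL : a ∈ L := Submodule.subset_span (by simp)
    have hAc : (∀ N, P N L → LeftPar (L : Set A) (N : Set A)) ∨
        (∀ N, P N L → RightPar (L : Set A) (N : Set A)) := by
      by_contra! hcon
      obtain ⟨⟨N, hN, hNl⟩, ⟨N', hN', hNr⟩⟩ := hcon
      have a1 := (hCLA _ _ (hsymm _ _ hN)).resolve_left hNl
      have a2 := (hCLA _ _ (hsymm _ _ hN')).resolve_right hNr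
      rcases hCLA _ _ (htrans _ _ _ hN (hsymm _ _ hN')) with h | h
      · exact hNl (a2.trans h.symm)
      · exact hNr (a1.trans h)
    have hBc : (∀ N, P N L → LeftPar (K : Set B) (e '' (N : Set A))) ∨
        (∀ N, P N L → RightPar (K : Set B) (e '' (N : Set A))) := by
      by_contra! hcon
      rw [← hLK] at hcon
      obtain ⟨⟨N, hN, hNl⟩, ⟨N', hN', hNr⟩⟩ := hcon
      have a1 := (hCLB _ _ (hsymm _ _ hN)).resolve_left hNl
      have a2 := (hCLB _ _ (hsymm _ _ hN')).resolve_right hNr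
      rcases hCLB _ _ (htrans _ _ _ hN (hsymm _ _ hN')) with h | h
      · exact hNl (a2.trans h.symm)
      · exact hNr (a1.trans h)
    have hAc' : (∀ N, P N L → ∀ x ∈ N, x ≠ 0 → x * a ∈ N) ∨
        (∀ N, P N L → ∀ x ∈ N, x ≠ 0 → a * x ∈ N) := by
      refine hAc.imp ?_ ?_
      · intro h N hN x hx hx0
        exact (eq_mul_of_left hLm hLi (h N hN) hx0 hx _).2 ⟨a, haL, rfl⟩
      · intro h N hN x hx hx0
        exact (eq_mul_of_right hLm hLi (h N hN) hx0 hx _).2 ⟨a, haL, rfl⟩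
    have gen : ∀ ψ : A → A, (∀ x y, ψ (x + y) = ψ x + ψ y) → ψ 1 = a →
        (∀ N, P N L → ∀ x ∈ N, x ≠ 0 → ψ x ∈ N) →
        (∀ x, e (ψ x) = e x * e a) ∨ (∀ x, e (ψ x) = e a * e x) := by
      intro ψ hψ hψ1 hψN
      have hadd : ∀ x y, e (ψ (e.symm (x + y))) = e (ψ (e.symm x)) + e (ψ (e.symm y)) := by
        intro x y; rw [map_add, hψ, map_add]
      have hs1 : e.symm 1 = 1 := by rw [← he1, e.symm_apply_apply]
      have hone : e (ψ (e.symm 1)) = e a := by rw [hs1, hψ1]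
      rcases hBc with h | h
      · left
        intro x
        have := key_left K.toAddSubgroup hKm hKi h1K hKne (e a) haK
          (fun x => e (ψ (e.symm x))) hadd ?_ hone (e x)
        · simpa using this
        · intro y hy0
          have hy0' : e.symm y ≠ 0 := by simpa using hy0
          obtain ⟨N, hN, hNL⟩ := hpar (e.symm y) hy0' L hLr
          exact (eq_mul_of_left hKm hKi (h N hNL) hy0 ⟨_, hN, by simp⟩ _).1
            ⟨_, hψN N hNL _ hN hy0', rfl⟩
      · right
        intro x
        have := key_right K.toAddSubgroup hKm hKi h1K hKne (e a) haK
          (fun x => e (ψ (e.symm x))) hadd ?_ hone (e x)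
        · simpa using this
        · intro y hy0
          have hy0' : e.symm y ≠ 0 := by simpa using hy0
          obtain ⟨N, hN, hNL⟩ := hpar (e.symm y) hy0' L hLr
          exact (eq_mul_of_right hKm hKi (h N hNL) hy0 ⟨_, hN, by simp⟩ _).1
            ⟨_, hψN N hNL _ hN hy0', rfl⟩
    rcases hAc' with h | h
    · rcases gen (fun x => x * a) (fun x y => add_mul x y a) (one_mul a) h with h | h
      · exact Or.inl h
      · exact Or.inr (Or.inl h)
    · rcases gen (fun x => a * x) (fun x y => mul_add a x y) (mul_one a) h with h | h
      · exact Or.inr (Or.inr (Or.inl h))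
      · exact Or.inr (Or.inr (Or.inr h))
  obtain ⟨i, hi⟩ := Subspace.exists_eq_top_of_iUnion_eq_univ
    (p := ![subLL e, subLR e, subRL e, subRR e]) (by
      rw [Set.eq_univ_iff_forall]
      intro a
      rw [Set.mem_iUnion]
      rcases hcase a with h | h | h | h
      · exact ⟨0, h⟩
      · exact ⟨1, h⟩
      · exact ⟨2, h⟩
      · exact ⟨3, h⟩)
  fin_cases i
  · left; intro x y
    exact (show y ∈ subLL e from (show subLL e = ⊤ from hi) ▸ Submodule.mem_top) x
  · right; intro x y
    exact (show y ∈ subLR e from (show subLR e = ⊤ from hi) ▸ Submodule.mem_top) x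
  · right; intro x y
    exact (show x ∈ subRL e from (show subRL e = ⊤ from hi) ▸ Submodule.mem_top) y
  · left; intro x y
    exact (show x ∈ subRR e from (show subRR e = ⊤ from hi) ▸ Submodule.mem_top) y

end core


/-- Let `A` and `B` be `F`-algebras, each subject to (A)
(a quaternion skew field with centre `F·1`) or (B) (commutative, with all
squares in `F·1`), of dimension `4` over `F`, and let `e : A → B` be an
`F`-linear bijection identifying the projective spaces `P(A_F)` and `P(B_F)`.
Suppose `P` is a parallelism on the lines of `A` that is Clifford-like with
respect to `(P(A_F), ∥ₗ^A, ∥ᵣ^A)` and whose transport along `e` is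
Clifford-like with respect to `(P(B_F), ∥ₗ^B, ∥ᵣ^B)`.  Then, possibly after
interchanging "left" and "right" on `B`, the double space structures agree
under `e`: for all lines `M, N` of `A`, either (`M ∥ₗ^A N ↔ e(M) ∥ₗ^B e(N)` and
`M ∥ᵣ^A N ↔ e(M) ∥ᵣ^B e(N)`), or (`M ∥ₗ^A N ↔ e(M) ∥ᵣ^B e(N)` and
`M ∥ᵣ^A N ↔ e(M) ∥ₗ^B e(N)`). -/
theorem stmt_15 {F A B : Type*} [Field F]
    [DivisionRing A] [Algebra F A] [DivisionRing B] [Algebra F B]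
    (hrankA : Module.finrank F A = 4)
    (hAB_A : (∀ z : A, z ∈ Subring.center A ↔ ∃ a : F, z = algebraMap F A a) ∨
      ((∀ x y : A, x * y = y * x) ∧ ∀ h : A, ∃ a : F, h ^ 2 = algebraMap F A a))
    (hrankB : Module.finrank F B = 4)
    (hAB_B : (∀ z : B, z ∈ Subring.center B ↔ ∃ a : F, z = algebraMap F B a) ∨
      ((∀ x y : B, x * y = y * x) ∧ ∀ h : B, ∃ a : F, h ^ 2 = algebraMap F B a))
    (e : A ≃ₗ[F] B)
    (P : Submodule F A → Submodule F A → Prop)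
    (hlines : ∀ M N, P M N → Module.finrank F M = 2 ∧ Module.finrank F N = 2)
    (hrefl : ∀ M : Submodule F A, Module.finrank F M = 2 → P M M)
    (hsymm : ∀ M N, P M N → P N M)
    (htrans : ∀ M N K, P M N → P N K → P M K)
    (hpar : ∀ x : A, x ≠ 0 → ∀ M : Submodule F A, Module.finrank F M = 2 →
      ∃! N : Submodule F A, x ∈ N ∧ P N M)
    (hCLA : ∀ M N, P M N →
      (∃ c : A, c ≠ 0 ∧ (N : Set A) = (fun y => c * y) '' (M : Set A)) ∨
      (∃ c : A, c ≠ 0 ∧ (N : Set A) = (fun y => y * c) '' (M : Set A)))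
    (hCLB : ∀ M N, P M N →
      (∃ d : B, d ≠ 0 ∧ ⇑e '' (N : Set A) = (fun y => d * y) '' (⇑e '' (M : Set A))) ∨
      (∃ d : B, d ≠ 0 ∧ ⇑e '' (N : Set A) = (fun y => y * d) '' (⇑e '' (M : Set A)))) :
    (∀ M N : Submodule F A, Module.finrank F M = 2 → Module.finrank F N = 2 →
      ((∃ c : A, c ≠ 0 ∧ (N : Set A) = (fun y => c * y) '' (M : Set A)) ↔
        (∃ d : B, d ≠ 0 ∧ ⇑e '' (N : Set A) = (fun y => d * y) '' (⇑e '' (M : Set A)))) ∧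
      ((∃ c : A, c ≠ 0 ∧ (N : Set A) = (fun y => y * c) '' (M : Set A)) ↔
        (∃ d : B, d ≠ 0 ∧ ⇑e '' (N : Set A) = (fun y => y * d) '' (⇑e '' (M : Set A))))) ∨
    (∀ M N : Submodule F A, Module.finrank F M = 2 → Module.finrank F N = 2 →
      ((∃ c : A, c ≠ 0 ∧ (N : Set A) = (fun y => c * y) '' (M : Set A)) ↔
        (∃ d : B, d ≠ 0 ∧ ⇑e '' (N : Set A) = (fun y => y * d) '' (⇑e '' (M : Set A)))) ∧
      ((∃ c : A, c ≠ 0 ∧ (N : Set A) = (fun y => y * c) '' (M : Set A)) ↔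
        (∃ d : B, d ≠ 0 ∧ ⇑e '' (N : Set A) = (fun y => d * y) '' (⇑e '' (M : Set A))))) := by
  have hfdB : FiniteDimensional F B := FiniteDimensional.of_finrank_pos (by omega)
  have hu : (e 1)⁻¹ ≠ 0 := inv_ne_zero (by simp)
  let m : B ≃ₗ[F] B := LinearEquiv.ofInjectiveEndo (LinearMap.mulLeft F (e 1)⁻¹)
    (mul_right_injective₀ hu)
  let e' : A ≃ₗ[F] B := e.trans m
  have he' : ∀ x, e' x = (e 1)⁻¹ * e x := fun x => rfl
  have him : ∀ S : Set A, e' '' S = (fun y => (e 1)⁻¹ * y) '' (e '' S) := by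
    intro S
    rw [Set.image_image]
    rfl
  have hL : ∀ S T : Set A, LeftPar (e' '' S) (e' '' T) ↔ LeftPar (e '' S) (e '' T) := by
    intro S T; rw [him, him, leftPar_smul_iff hu]
  have hR : ∀ S T : Set A, RightPar (e' '' S) (e' '' T) ↔ RightPar (e '' S) (e '' T) := by
    intro S T; rw [him, him, rightPar_smul_iff hu]
  rcases core hrankA hAB_A hrankB hAB_B e' (by rw [he']; exact inv_mul_cancel₀ (by simp)) P
    hsymm htrans (fun x hx M hM => (hpar x hx M hM).exists) hCLA
    (fun M N h => by rw [hL, hR]; exact hCLB M N h) with h | h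
  · left
    intro M N _ _
    have := mult_par e' h (M : Set A) (N : Set A)
    rw [hL, hR] at this
    exact this
  · right
    intro M N _ _
    have := anti_par e' h (M : Set A) (N : Set A)
    rw [hL, hR] at this
    exact this
end

section
/- Let H be a quaternion skew field with centre F and let ∥ be a Clifford-like parallelism of (P(H_F), ∥ₗ, ∥ᵣ) with ∥ ≠ ∥ₗ and ∥ ≠ ∥ᵣ (a proper Clifford-like parallelism). Then ∥ is not a Clifford parallelism of any double space structure on P(H_F): there is no F-algebra B subject to (A) or (B) and no F-linear bijection e : H → B such that for all lines M, N of H one has M ∥ N ⇔ (∃ d ∈ B∖{0}, e(N) = e(M)·d). -/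
lemma aux_left {D : Type*} [DivisionRing D] (T : D →+ D) (L : Set D)
    (hsub : ∀ x ∈ L, ∀ y ∈ L, x - y ∈ L) (hmul : ∀ x ∈ L, ∀ y ∈ L, x * y ∈ L)
    (hinv : ∀ x ∈ L, x⁻¹ ∈ L) (hz : ∃ z, z ∉ L)
    (hT : ∀ x, ∃ l ∈ L, T x = x * l) (x : D) : T x = x * T 1 := by
  have key : ∀ x y l m, x ≠ 0 → x⁻¹ * y ∉ L → l ∈ L → m ∈ L → T x = x * l → T y = y * m →
      l = m := by
    intro x y l m hx hxy hl hm h1 h2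
    obtain ⟨n, hn, h3⟩ := hT (x + y)
    rw [map_add, h1, h2] at h3
    have h4 : x * (l - n) = y * (n - m) := by
      rw [mul_sub, mul_sub]
      rw [add_mul] at h3
      rw [sub_eq_sub_iff_add_eq_add, h3]; abel
    by_cases hnm : n - m = 0
    · rw [hnm, mul_zero, mul_eq_zero] at h4
      have h5 := h4.resolve_left hx
      rw [sub_eq_zero] at h5 hnm
      rw [h5, hnm]
    · exfalso
      apply hxy
      have : x⁻¹ * y = (l - n) * (n - m)⁻¹ := by
        rw [eq_mul_inv_iff_mul_eq₀ hnm, mul_assoc, ← h4, inv_mul_cancel_left₀ hx]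
      rw [this]
      exact hmul _ (hsub _ hl _ hn) _ (hinv _ (hsub _ hn _ hm))
  obtain ⟨l1, hl1, h1⟩ := hT 1
  have hone : T 1 = l1 := by simpa using h1
  have out : ∀ x, x ∉ L → T x = x * T 1 := by
    intro x hx
    obtain ⟨l, hl, h⟩ := hT x
    have := key 1 x l1 l one_ne_zero (by simpa using hx) hl1 hl h1 h
    rw [h, hone, this]
  by_cases hx : x ∈ L
  · by_cases hx0 : x = 0
    · simp [hx0]
    · obtain ⟨z, hz⟩ := hz
      obtain ⟨l, hl, h⟩ := hT x
      have := key x z l l1 hx0 (fun hq => hz (by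
        have := hmul _ hx _ hq
        rwa [mul_inv_cancel_left₀ hx0] at this)) hl hl1 h (by rw [out z hz, hone])
      rw [h, hone, this]
  · exact out x hx

open MulOpposite in
lemma aux_right {D : Type*} [DivisionRing D] (T : D →+ D) (L : Set D)
    (hsub : ∀ x ∈ L, ∀ y ∈ L, x - y ∈ L) (hmul : ∀ x ∈ L, ∀ y ∈ L, x * y ∈ L)
    (hinv : ∀ x ∈ L, x⁻¹ ∈ L) (hz : ∃ z, z ∉ L)
    (hT : ∀ x, ∃ l ∈ L, T x = l * x) (x : D) : T x = T 1 * x := by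
  have := aux_left (D := Dᵐᵒᵖ)
    (opAddEquiv.toAddMonoidHom.comp (T.comp opAddEquiv.symm.toAddMonoidHom))
    (unop ⁻¹' L)
    (fun x hx y hy => by simpa using hsub _ hx _ hy)
    (fun x hx y hy => by simpa using hmul _ hy _ hx)
    (fun x hx => by simpa using hinv _ hx)
    (by obtain ⟨z, hz⟩ := hz; exact ⟨op z, by simpa using hz⟩)
    (fun x => by
      obtain ⟨l, hl, h⟩ := hT (unop x)
      exact ⟨op l, by simpa using hl, by simp [h]⟩) (op x)
  simpa [← op_mul] using this

/-- A noncentral element lies in a line through `1` which is a subfield. -/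
lemma aux_line {F H : Type*} [Field F] [DivisionRing H] [Algebra F H]
    (hrank : Module.finrank F H = 4) (a : H)
    (hcenter : ∀ z : H, z ∈ Subring.center H ↔ ∃ a : F, z = algebraMap F H a)
    (ha : ¬ ∃ r : F, a = algebraMap F H r) :
    ∃ L : Submodule F H, Module.finrank F L = 2 ∧ a ∈ L ∧ (1 : H) ∈ L ∧
      (∀ x ∈ L, ∀ y ∈ L, x * y ∈ L) ∧ (∀ x ∈ L, x⁻¹ ∈ L) ∧ ∃ z, z ∉ L := by
  have hfin : FiniteDimensional F H := Module.finite_of_finrank_pos (by omega)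
  let L : Submodule F H := Subalgebra.toSubmodule (Subalgebra.centralizer F {a})
  have hmem : ∀ x, x ∈ L ↔ a * x = x * a := by
    intro x
    simp [L, Subalgebra.mem_centralizer_iff]
  have hmul : ∀ x ∈ L, ∀ y ∈ L, x * y ∈ L := by
    intro x hx y hy
    rw [hmem] at *
    rw [← mul_assoc, hx, mul_assoc, hy, mul_assoc]
  have hinv : ∀ x ∈ L, x⁻¹ ∈ L := by
    intro x hx
    rw [hmem] at *
    have : Commute a x := hx
    exact this.inv_right₀
  have hz : ∃ z, z ∉ L := by
    by_contra! h
    apply ha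
    rw [← hcenter, Subring.mem_center_iff]
    intro g
    exact ((hmem g).1 (h g)).symm
  have h1 : (1 : H) ∈ L := by rw [hmem]; simp
  have haL : a ∈ L := by rw [hmem]
  refine ⟨L, le_antisymm ?_ ?_, haL, h1, hmul, hinv, hz⟩
  · obtain ⟨z, hz⟩ := hz
    have hz0 : z ≠ 0 := fun h => hz (h ▸ L.zero_mem)
    let Lz := L.map (LinearMap.mulRight F z)
    have hLz : Module.finrank F Lz = Module.finrank F L :=
      LinearEquiv.finrank_eq (Submodule.equivMapOfInjective (LinearMap.mulRight F z)
        (fun x y h => mul_right_cancel₀ hz0 h) L).symm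
    have hdis : L ⊓ Lz = ⊥ := by
      rw [eq_bot_iff]
      rintro x ⟨hx, y, hy, hxy⟩
      simp only [LinearMap.mulRight_apply] at hxy
      by_contra hx0
      have hy0 : y ≠ 0 := by
        rintro rfl
        apply hx0
        simp [← hxy]
      apply hz
      have := hmul _ (hinv _ hy) _ hx
      rwa [← hxy, inv_mul_cancel_left₀ hy0] at this
    have := Submodule.finrank_sup_add_finrank_inf_eq L Lz
    rw [hdis, finrank_bot, hLz] at this
    have h2 := Submodule.finrank_le (L ⊔ Lz)
    omega
  · have hli : LinearIndependent F ![(1 : H), a] := by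
      rw [LinearIndependent.pair_iff' one_ne_zero]
      intro r hr
      exact ha ⟨r, by rw [← hr, Algebra.algebraMap_eq_smul_one]⟩
    have h2 := finrank_span_eq_card hli
    have h3 : Submodule.span F (Set.range ![(1 : H), a]) ≤ L := by
      rw [Submodule.span_le]
      rintro _ ⟨i, rfl⟩
      fin_cases i
      · exact h1
      · exact haL
    have := Submodule.finrank_mono h3
    simp at h2
    simp at this
    omega


/-- Let `H` be a quaternion skew field with centre `F` and let
`P` be a proper Clifford-like parallelism of `(P(H_F), ∥ₗ, ∥ᵣ)`, i.e. one
coinciding with neither the left nor the right Clifford parallelism.  Then `P`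
is not a Clifford parallelism of any double space structure on `P(H_F)`: there
is no `F`-algebra `B` subject to (A) or (B) and no `F`-linear bijection
`e : H → B` such that `M ∥ N` iff `e(N) = e(M)·d` for some `d ∈ B∖{0}`. -/
theorem stmt_16 {F H : Type*} [Field F] [DivisionRing H] [Algebra F H]
    (hrank : Module.finrank F H = 4)
    (hcenter : ∀ z : H, z ∈ Subring.center H ↔ ∃ a : F, z = algebraMap F H a)
    (P : Submodule F H → Submodule F H → Prop)
    (hlines : ∀ M N, P M N → Module.finrank F M = 2 ∧ Module.finrank F N = 2)
    (hrefl : ∀ M : Submodule F H, Module.finrank F M = 2 → P M M)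
    (hsymm : ∀ M N, P M N → P N M)
    (htrans : ∀ M N K, P M N → P N K → P M K)
    (hpar : ∀ x : H, x ≠ 0 → ∀ M : Submodule F H, Module.finrank F M = 2 →
      ∃! N : Submodule F H, x ∈ N ∧ P N M)
    (hCL : ∀ M N, P M N →
      (∃ c : H, c ≠ 0 ∧ (N : Set H) = (fun y => c * y) '' (M : Set H)) ∨
      (∃ c : H, c ≠ 0 ∧ (N : Set H) = (fun y => y * c) '' (M : Set H)))
    (hnotl : ¬ (∀ M N : Submodule F H, Module.finrank F M = 2 → Module.finrank F N = 2 →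
      (P M N ↔ ∃ c : H, c ≠ 0 ∧ (N : Set H) = (fun y => c * y) '' (M : Set H))))
    (hnotr : ¬ (∀ M N : Submodule F H, Module.finrank F M = 2 → Module.finrank F N = 2 →
      (P M N ↔ ∃ c : H, c ≠ 0 ∧ (N : Set H) = (fun y => y * c) '' (M : Set H)))) :
    ∀ (B : Type*) [DivisionRing B] [Algebra F B],
      Module.finrank F B = 4 →
      ((∀ z : B, z ∈ Subring.center B ↔ ∃ a : F, z = algebraMap F B a) ∨
        ((∀ x y : B, x * y = y * x) ∧ ∀ h : B, ∃ a : F, h ^ 2 = algebraMap F B a)) →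
      ¬ ∃ e : H ≃ₗ[F] B,
          ∀ M N : Submodule F H, Module.finrank F M = 2 → Module.finrank F N = 2 →
            (P M N ↔ ∃ d : B, d ≠ 0 ∧
              ⇑e '' (N : Set H) = (fun y => y * d) '' (⇑e '' (M : Set H))) := by
  intro B _ _ hB _ ⟨e, he⟩
  have hfin : FiniteDimensional F H := Module.finite_of_finrank_pos (by omega)
  have he1 : e 1 ≠ 0 := by simp
  -- the transported multiplication
  let T : H → (H →ₗ[F] H) := fun a =>
    e.symm.toLinearMap ∘ₗ (LinearMap.mulLeft F (e a * (e 1)⁻¹)) ∘ₗ e.toLinearMap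
  have hTe : ∀ a x, e (T a x) = e a * (e 1)⁻¹ * e x := by
    intro a x; simp [T, mul_assoc]
  have hT1 : ∀ a, T a 1 = a := by
    intro a
    apply e.injective
    rw [hTe, inv_mul_cancel_right₀ he1]
  have main : ∀ a, (∀ x, T a x = a * x) ∨ (∀ x, T a x = x * a) := by
    intro a
    by_cases ha : ∃ r : F, a = algebraMap F H r
    · left
      obtain ⟨r, rfl⟩ := ha
      intro x
      apply e.injective
      rw [hTe, Algebra.algebraMap_eq_smul_one, map_smul, smul_mul_assoc, smul_mul_assoc,
        mul_inv_cancel₀ he1, one_mul, smul_mul_assoc, one_mul, map_smul]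
    obtain ⟨L, hL2, haL, h1L, hmul, hinv, hz⟩ := aux_line hrank a hcenter ha
    -- parallel line through x
    have hN : ∀ x, x ≠ 0 → ∃ N : Submodule F H, P L N ∧ x ∈ N ∧ T a x ∈ N := by
      intro x hx
      have hex : e x ≠ 0 := by simpa using hx
      have hd : (e 1)⁻¹ * e x ≠ 0 := mul_ne_zero (inv_ne_zero he1) hex
      let g : H →ₗ[F] H :=
        e.symm.toLinearMap ∘ₗ (LinearMap.mulRight F ((e 1)⁻¹ * e x)) ∘ₗ e.toLinearMap
      have hge : ∀ y, e (g y) = e y * ((e 1)⁻¹ * e x) := by intro y; simp [g, mul_assoc]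
      have hg : Function.Injective g := by
        intro y z h
        have hq := congrArg e h
        rw [hge, hge] at hq
        exact e.injective (mul_right_cancel₀ hd hq)
      have hN2 : Module.finrank F (L.map g) = 2 := by
        rw [← hL2]
        exact (LinearEquiv.finrank_eq (Submodule.equivMapOfInjective g hg L)).symm
      refine ⟨L.map g, ?_, ⟨1, h1L, ?_⟩, ⟨a, haL, ?_⟩⟩
      · rw [he _ _ hL2 hN2]
        refine ⟨_, hd, ?_⟩
        rw [Submodule.map_coe, Set.image_image, Set.image_image]
        exact Set.image_congr (fun y _ => hge y)
      · apply e.injective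
        rw [hge, mul_inv_cancel_left₀ he1]
      · apply e.injective
        rw [hge, hTe, mul_assoc]
    have hlc : ∀ (N : Submodule F H) (x c : H), x ≠ 0 → x ∈ N →
        (N : Set H) = (fun y => c * y) '' (L : Set H) → ∀ y, y ∈ N ↔ ∃ l ∈ L, y = x * l := by
      intro N x c hx hxN hNc y
      have hmem : ∀ y, y ∈ N ↔ ∃ l ∈ L, c * l = y := by
        intro y; rw [← SetLike.mem_coe, hNc]; rfl
      obtain ⟨m, hm, rfl⟩ := (hmem x).1 hxN
      have hm0 : m ≠ 0 := right_ne_zero_of_mul hx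
      rw [hmem]
      constructor
      · rintro ⟨l, hl, rfl⟩
        exact ⟨m⁻¹ * l, hmul _ (hinv _ hm) _ hl, by rw [mul_assoc, mul_inv_cancel_left₀ hm0]⟩
      · rintro ⟨l, hl, rfl⟩
        exact ⟨m * l, hmul _ hm _ hl, by rw [mul_assoc]⟩
    have hrc : ∀ (N : Submodule F H) (x c : H), x ≠ 0 → x ∈ N →
        (N : Set H) = (fun y => y * c) '' (L : Set H) → ∀ y, y ∈ N ↔ ∃ l ∈ L, y = l * x := by
      intro N x c hx hxN hNc y
      have hmem : ∀ y, y ∈ N ↔ ∃ l ∈ L, l * c = y := by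
        intro y; rw [← SetLike.mem_coe, hNc]; rfl
      obtain ⟨m, hm, rfl⟩ := (hmem x).1 hxN
      have hm0 : m ≠ 0 := left_ne_zero_of_mul hx
      rw [hmem]
      constructor
      · rintro ⟨l, hl, rfl⟩
        exact ⟨l * m⁻¹, hmul _ hl _ (hinv _ hm), by
          rw [← mul_assoc, inv_mul_cancel_right₀ hm0]⟩
      · rintro ⟨l, hl, rfl⟩
        exact ⟨l * m, hmul _ hl _ hm, by rw [mul_assoc]⟩
    have hdich : (∀ x, ∃ l ∈ L, T a x = x * l) ∨ (∀ x, ∃ l ∈ L, T a x = l * x) := by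
      by_contra! hcon
      obtain ⟨⟨y, hy⟩, ⟨x, hx⟩⟩ := hcon
      have hx0 : x ≠ 0 := by
        rintro rfl; exact hx 0 L.zero_mem (by simp)
      have hy0 : y ≠ 0 := by
        rintro rfl; exact hy 0 L.zero_mem (by simp)
      obtain ⟨N, hLN, hxN, hTN⟩ := hN x hx0
      obtain ⟨K, hLK, hyK, hTK⟩ := hN y hy0
      -- `N = x L`, `K = L y`
      have hNx : ∀ w, w ∈ N ↔ ∃ l ∈ L, w = x * l := by
        rcases hCL _ _ hLN with ⟨c, _, h⟩ | ⟨c, _, h⟩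
        · exact hlc N x c hx0 hxN h
        · obtain ⟨l, hl, hq⟩ := (hrc N x c hx0 hxN h _).1 hTN
          exact absurd hq (hx l hl)
      have hKy : ∀ w, w ∈ K ↔ ∃ l ∈ L, w = l * y := by
        rcases hCL _ _ hLK with ⟨c, _, h⟩ | ⟨c, _, h⟩
        · obtain ⟨l, hl, hq⟩ := (hlc K y c hy0 hyK h _).1 hTK
          exact absurd hq (hy l hl)
        · exact hrc K y c hy0 hyK h
      rcases hCL _ _ (htrans _ _ _ (hsymm _ _ hLN) hLK) with ⟨c, _, h⟩ | ⟨c, hc, h⟩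
      · -- `K = c x L`
        have : (K : Set H) = (fun y => (c * x) * y) '' (L : Set H) := by
          ext w
          rw [h]
          constructor
          · rintro ⟨n, hn, rfl⟩
            obtain ⟨l, hl, rfl⟩ := (hNx n).1 hn
            exact ⟨l, hl, mul_assoc _ _ _⟩
          · rintro ⟨l, hl, rfl⟩
            exact ⟨x * l, (hNx _).2 ⟨l, hl, rfl⟩, (mul_assoc _ _ _).symm⟩
        obtain ⟨l, hl, hq⟩ := (hlc K y _ hy0 hyK this _).1 hTK
        exact hy l hl hq
      · -- `L y = x L c`
        have hmem : ∀ y, y ∈ K ↔ ∃ l ∈ L, x * l * c = y := by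
          intro y
          rw [← SetLike.mem_coe, h]
          constructor
          · rintro ⟨n, hn, rfl⟩
            obtain ⟨l, hl, rfl⟩ := (hNx n).1 hn
            exact ⟨l, hl, rfl⟩
          · rintro ⟨l, hl, rfl⟩
            exact ⟨x * l, (hNx _).2 ⟨l, hl, rfl⟩, rfl⟩
        obtain ⟨m, hm, hmy⟩ := (hmem y).1 hyK
        have hm0 : m ≠ 0 := by
          rintro rfl; apply hy0; simp [← hmy]
        -- `x L x⁻¹ ⊆ L`
        obtain ⟨l, hl, hTl⟩ := (hNx _).1 hTN
        have h2 : x * (l * m) * c ∈ K := (hmem _).2 ⟨l * m, hmul _ hl _ hm, rfl⟩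
        obtain ⟨k, hk, hk2⟩ := (hKy _).1 h2
        apply hx k hk
        rw [hTl]
        rw [← hmy] at hk2
        have h3 : (x * l) * (m * c) = (k * x) * (m * c) := by
          simpa only [mul_assoc] using hk2
        exact mul_right_cancel₀ (mul_ne_zero hm0 hc) h3
    rcases hdich with h | h
    · right
      intro x
      have := aux_left (T a).toAddMonoidHom (L : Set H) (fun x hx y hy => L.sub_mem hx hy)
        hmul hinv hz h x
      simpa [hT1] using this
    · left
      intro x
      have := aux_right (T a).toAddMonoidHom (L : Set H) (fun x hx y hy => L.sub_mem hx hy)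
        hmul hinv hz h x
      simpa [hT1] using this
  have hTadd : ∀ a b x, T (a + b) x = T a x + T b x := by
    intro a b x
    apply e.injective
    rw [map_add, hTe, hTe, hTe, map_add]
    noncomm_ring
  have main2 : (∀ a x, T a x = a * x) ∨ (∀ a x, T a x = x * a) := by
    by_contra! hcon
    obtain ⟨⟨a, x, hax⟩, ⟨b, y, hby⟩⟩ := hcon
    have ha : ∀ x, T a x = x * a := (main a).resolve_left (fun h => hax (h x))
    have hb : ∀ x, T b x = b * x := (main b).resolve_right (fun h => hby (h y))
    rcases main (a + b) with h | h
    · apply hax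
      have := h x
      rw [hTadd, hb, add_mul] at this
      exact add_right_cancel this
    · apply hby
      have := h y
      rw [hTadd, ha, mul_add] at this
      exact add_left_cancel this
  rcases main2 with h | h
  · apply hnotr
    intro M N hM hN
    rw [he M N hM hN]
    have hk : ∀ c : H, ⇑e '' (N : Set H) = (fun y => y * ((e 1)⁻¹ * e c)) '' (⇑e '' (M : Set H)) ↔
        (N : Set H) = (fun y => y * c) '' (M : Set H) := by
      intro c
      have : (fun y => y * ((e 1)⁻¹ * e c)) '' (⇑e '' (M : Set H)) =
          ⇑e '' ((fun y => y * c) '' (M : Set H)) := by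
        rw [Set.image_image, Set.image_image]
        refine Set.image_congr (fun y _ => ?_)
        rw [← h, hTe, mul_assoc]
      rw [this, Set.image_eq_image e.injective]
    constructor
    · rintro ⟨d, hd, hN⟩
      refine ⟨e.symm (e 1 * d), by simp [hd], ?_⟩
      rw [← hk]
      simpa [inv_mul_cancel_left₀ he1] using hN
    · rintro ⟨c, hc, hN⟩
      exact ⟨(e 1)⁻¹ * e c, mul_ne_zero (inv_ne_zero he1) (by simpa using hc), (hk c).2 hN⟩
  · apply hnotl
    intro M N hM hN
    rw [he M N hM hN]
    have hk : ∀ c : H, ⇑e '' (N : Set H) = (fun y => y * ((e 1)⁻¹ * e c)) '' (⇑e '' (M : Set H)) ↔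
        (N : Set H) = (fun y => c * y) '' (M : Set H) := by
      intro c
      have : (fun y => y * ((e 1)⁻¹ * e c)) '' (⇑e '' (M : Set H)) =
          ⇑e '' ((fun y => c * y) '' (M : Set H)) := by
        rw [Set.image_image, Set.image_image]
        refine Set.image_congr (fun y _ => ?_)
        rw [← h, hTe, mul_assoc]
      rw [this, Set.image_eq_image e.injective]
    constructor
    · rintro ⟨d, hd, hN⟩
      refine ⟨e.symm (e 1 * d), by simp [hd], ?_⟩
      rw [← hk]
      simpa [inv_mul_cancel_left₀ he1] using hN
    · rintro ⟨c, hc, hN⟩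
      exact ⟨(e 1)⁻¹ * e c, mul_ne_zero (inv_ne_zero he1) (by simpa using hc), (hk c).2 hN⟩
end

section
/- Let H be a quaternion skew field with centre F and let L₁ ≠ L₂ be two distinct 2-dimensional F-subspaces of H, each containing 1. Then the F-subalgebra of H generated by L₁ ∪ L₂ is all of H (Algebra.adjoin F (L₁ ∪ L₂) = ⊤); equivalently, the division subring of H generated by L₁ ∪ L₂ equals H. -/
/-- Let `H` be a quaternion skew field with centre `F` and let
`L₁ ≠ L₂` be two distinct `2`-dimensional `F`-subspaces of `H`, each containing
`1`.  Then the `F`-subalgebra of `H` generated by `L₁ ∪ L₂` is all of `H`. -/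
theorem stmt_17 {F H : Type*} [Field F] [DivisionRing H] [Algebra F H]
    (hrank : Module.finrank F H = 4)
    (hcenter : ∀ z : H, z ∈ Subring.center H ↔ ∃ a : F, z = algebraMap F H a)
    (L₁ L₂ : Submodule F H)
    (hL₁ : Module.finrank F L₁ = 2) (hL₂ : Module.finrank F L₂ = 2)
    (h1L₁ : (1 : H) ∈ L₁) (h1L₂ : (1 : H) ∈ L₂)
    (hne : L₁ ≠ L₂) :
    Algebra.adjoin F ((L₁ : Set H) ∪ (L₂ : Set H)) = ⊤ := by
  have hfin : FiniteDimensional F H := Module.finite_of_finrank_pos (by omega)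
  set A := Algebra.adjoin F ((L₁ : Set H) ∪ (L₂ : Set H)) with hA
  have h1 : L₁ ≤ Subalgebra.toSubmodule A := fun x hx =>
    Algebra.subset_adjoin (Or.inl hx)
  have h2 : L₂ ≤ Subalgebra.toSubmodule A := fun x hx =>
    Algebra.subset_adjoin (Or.inr hx)
  have hlt : L₁ < Subalgebra.toSubmodule A := by
    refine lt_of_le_of_ne h1 fun h => hne ?_
    exact (Submodule.eq_of_le_of_finrank_eq (h ▸ h2) (by omega)).symm
  have h3 : 2 < Module.finrank F A := by
    have := Submodule.finrank_lt_finrank_of_lt hlt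
    rw [hL₁] at this
    exact this
  by_contra htop
  obtain ⟨h, hh⟩ : ∃ h : H, h ∉ A := by
    by_contra hc
    push Not at hc
    exact htop (Algebra.eq_top_iff.2 hc)
  have hinv : ∀ b : A, b ≠ 0 → ∃ c : A, c * b = 1 := by
    intro b hb
    have hinj : Function.Injective (LinearMap.mulRight F b) := by
      intro x y hxy
      exact mul_right_cancel₀ hb hxy
    exact LinearMap.injective_iff_surjective.1 hinj 1
  let f : (A × A) →ₗ[F] H :=
    LinearMap.coprod A.val.toLinearMap ((LinearMap.mulRight F h) ∘ₗ A.val.toLinearMap)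
  have hf : ∀ a b : A, f (a, b) = (a : H) + (b : H) * h := fun a b => by simp [f]
  have hfi : Function.Injective f := by
    rw [injective_iff_map_eq_zero]
    rintro ⟨a, b⟩ hab
    rw [hf] at hab
    by_cases hb : b = 0
    · subst hb
      have : a = 0 := by simpa using hab
      simp [this]
    · exfalso
      obtain ⟨c, hc⟩ := hinv b hb
      have hc' : (c : H) * (b : H) = 1 := by exact_mod_cast congrArg Subtype.val hc
      apply hh
      have e : h = ((-(c * a) : A) : H) := by
        have e1 : (b : H) * h = -(a : H) := by
          rw [eq_neg_iff_add_eq_zero, add_comm]; exact hab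
        calc h = (c : H) * (b : H) * h := by rw [hc', one_mul]
          _ = (c : H) * -(a : H) := by rw [mul_assoc, e1]
          _ = _ := by simp
      rw [e]
      exact Subtype.property _
  have := LinearMap.finrank_le_finrank_of_injective hfi
  rw [Module.finrank_prod] at this
  omega
end

section
/- Let H be a quaternion skew field with centre F and let L be a 2-dimensional F-subspace of H with 1 ∈ L. Then L is closed under multiplication and inversion, hence is a commutative subfield of H containing F·1; moreover L is a maximal commutative subring of H: every commutative subring R of H with L ⊆ R satisfies R = L. -/
/-- A commutative subalgebra of `H` has dimension at most two. -/
theorem comm_subalgebra_finrank_le {F H : Type*} [Field F] [DivisionRing H] [Algebra F H]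
    (hrank : Module.finrank F H = 4)
    (hcenter : ∀ z : H, z ∈ Subring.center H ↔ ∃ a : F, z = algebraMap F H a)
    (K : Subalgebra F H) (hK : ∀ x ∈ K, ∀ y ∈ K, x * y = y * x) :
    Module.finrank F K ≤ 2 := by
  have : FiniteDimensional F H := FiniteDimensional.of_finrank_eq_succ hrank
  have : FiniteDimensional F K := inferInstanceAs (FiniteDimensional F K.toSubmodule)
  have : Module.Free K H := by
    let : DivisionRing K := divisionRingOfFiniteDimensional F K
    exact Module.Free.of_divisionRing K H
  have : StrongRankCondition K := by
    let : DivisionRing K := divisionRingOfFiniteDimensional F K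
    exact (inferInstance : StrongRankCondition K)
  have hmul := Module.finrank_mul_finrank F K H
  rw [hrank] at hmul
  have hne : Module.finrank F K ≠ 4 := by
    intro h4
    have htop : K.toSubmodule = ⊤ := Submodule.eq_top_of_finrank_eq (by rw [hrank]; exact h4)
    have hall : ∀ x : H, x ∈ K := fun x => by
      have : x ∈ K.toSubmodule := htop ▸ Submodule.mem_top
      exact this
    have hle : Module.finrank F H ≤ 1 := by
      apply finrank_le_one (1 : H)
      intro w
      obtain ⟨a, ha⟩ := (hcenter w).1
        (Subring.mem_center_iff.2 fun g => hK g (hall g) w (hall w))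
      exact ⟨a, by rw [ha, Algebra.algebraMap_eq_smul_one]⟩
    omega
  have hdvd : Module.finrank F K ∣ 4 := ⟨_, hmul.symm⟩
  have hle := Nat.le_of_dvd (by norm_num) hdvd
  by_contra hcon
  have h3 : Module.finrank F K = 3 := by omega
  rw [h3] at hdvd
  omega

/-- Let `H` be a quaternion skew field with centre `F` and let
`L` be a `2`-dimensional `F`-subspace of `H` with `1 ∈ L`.  Then `L` is closed
under multiplication and inversion, hence a commutative subfield of `H`
containing `F·1`; moreover `L` is a maximal commutative subring of `H`: every
commutative subring `R` of `H` with `L ⊆ R` satisfies `R = L`. -/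
theorem stmt_18 {F H : Type*} [Field F] [DivisionRing H] [Algebra F H]
    (hrank : Module.finrank F H = 4)
    (hcenter : ∀ z : H, z ∈ Subring.center H ↔ ∃ a : F, z = algebraMap F H a)
    (L : Submodule F H) (hL : Module.finrank F L = 2) (h1L : (1 : H) ∈ L) :
    (∀ x ∈ L, ∀ y ∈ L, x * y ∈ L) ∧
    (∀ x ∈ L, x ≠ 0 → x⁻¹ ∈ L) ∧
    (∀ x ∈ L, ∀ y ∈ L, x * y = y * x) ∧
    (∀ a : F, algebraMap F H a ∈ L) ∧
    (∀ R : Subring H, (∀ x ∈ R, ∀ y ∈ R, x * y = y * x) →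
      (L : Set H) ⊆ (R : Set H) → (R : Set H) = (L : Set H)) := by
  have : FiniteDimensional F H := FiniteDimensional.of_finrank_eq_succ hrank
  have hF : ∀ a : F, algebraMap F H a ∈ L := fun a => by
    rw [Algebra.algebraMap_eq_smul_one]; exact L.smul_mem a h1L
  have key : ∀ K : Subalgebra F H, (∀ x ∈ K, ∀ y ∈ K, x * y = y * x) →
      L ≤ K.toSubmodule → L = K.toSubmodule := by
    intro K hK hLK
    apply Submodule.eq_of_le_of_finrank_le hLK
    rw [hL]
    exact comm_subalgebra_finrank_le hrank hcenter K hK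
  obtain ⟨x, hxL, hx⟩ : ∃ x ∈ L, x ∉ Submodule.span F {(1 : H)} := by
    by_contra! hcon
    have h := Submodule.finrank_mono (R := F) (show L ≤ Submodule.span F {(1 : H)} from hcon)
    rw [hL, finrank_span_singleton one_ne_zero] at h
    omega
  have hspan : Submodule.span F {(1 : H), x} = L := by
    apply Submodule.eq_of_le_of_finrank_le
    · rw [Submodule.span_le]
      rintro y (rfl | rfl)
      · exact h1L
      · exact hxL
    · rw [hL]
      have hlt : Submodule.span F {(1 : H)} < Submodule.span F {(1 : H), x} := by
        apply lt_of_le_of_ne (Submodule.span_mono (by simp))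
        intro h
        exact hx (h ▸ Submodule.subset_span (by simp))
      have h := Submodule.finrank_lt_finrank_of_lt hlt
      rw [finrank_span_singleton one_ne_zero] at h
      omega
  obtain ⟨K, hK, hLK⟩ : ∃ K : Subalgebra F H, (∀ x ∈ K, ∀ y ∈ K, x * y = y * x) ∧
      L = K.toSubmodule := by
    have hc : ∀ y ∈ Algebra.adjoin F {x}, ∀ z ∈ Algebra.adjoin F {x}, y * z = z * y := by
      intro y hy z hz
      exact congrArg Subtype.val
        (mul_comm (⟨y, hy⟩ : Algebra.adjoin F {x}) ⟨z, hz⟩)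
    refine ⟨_, hc, key _ hc ?_⟩
    rw [← hspan, Submodule.span_le]
    rintro y (rfl | rfl)
    · exact one_mem (Algebra.adjoin F {x})
    · exact Algebra.subset_adjoin rfl
  have hmem : ∀ y, y ∈ L ↔ y ∈ K := fun y => by rw [hLK]; exact Iff.rfl
  refine ⟨?_, ?_, ?_, hF, ?_⟩
  · intro y hy z hz
    rw [hmem] at *
    exact K.mul_mem hy hz
  · intro y hy hy0
    rw [hmem] at *
    have : FiniteDimensional F K := inferInstanceAs (FiniteDimensional F K.toSubmodule)
    let : DivisionRing K := divisionRingOfFiniteDimensional F K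
    have hne : (⟨y, hy⟩ : K) ≠ 0 := fun h => hy0 (congrArg Subtype.val h)
    have h : y * ((⟨y, hy⟩ : K)⁻¹ : K).1 = 1 :=
      congrArg Subtype.val (mul_inv_cancel₀ hne)
    rw [inv_eq_of_mul_eq_one_right h]
    exact Subtype.property _
  · intro y hy z hz
    rw [hmem] at *
    exact hK y hy z hz
  · intro R hR hLR
    let S : Subalgebra F H := { R with algebraMap_mem' := fun a => hLR (hF a) }
    have h := key S hR hLR
    rw [h]
    rfl
end

section
/- Let F ⊆ H be commutative fields with [H : F] = 4 and h² ∈ F for every h ∈ H, and define the (Clifford) parallelism ∥ on 2-dimensional F-subspaces of H by: M ∥ N iff N = c·M for some c ∈ H∖{0}. Let σ be a field automorphism of F and β : H → H an additive bijection with β(a·x) = σ(a)·β(x) for all a ∈ F, x ∈ H, such that M ∥ N implies β(M) ∥ β(N). If β fixes all lines of at least one parallel class — i.e. there is a line L with β(c·L) = c·L for every c ∈ H∖{0} — then β stabilises every parallel class: β(M) ∥ M for every 2-dimensional F-subspace M of H. -/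
/-- Let `F ⊆ H` be commutative fields with `[H : F] = 4` and
`h² ∈ F` for every `h ∈ H` (case (B)), and consider the Clifford parallelism on
lines (2-dimensional `F`-subspaces) of `H`: `M ∥ N` iff `N = c·M` for some
`c ∈ H∖{0}`.  Let `σ` be a field automorphism of `F` and `β : H → H` an additive
bijection with `β (a • x) = σ a • β x` mapping parallel lines to parallel lines.
If `β` fixes all lines of at least one parallel class — there is a line `L` with
`β(c·L) = c·L` for every `c ∈ H∖{0}` — then `β` stabilises every parallel class:
`β(M) ∥ M` for every line `M`. -/
theorem stmt_19 {F H : Type*} [Field F] [Field H] [Algebra F H]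
    (hrank : Module.finrank F H = 4)
    (hsq : ∀ h : H, ∃ a : F, h ^ 2 = algebraMap F H a)
    (σ : F ≃+* F) (β : H ≃+ H)
    (hsemi : ∀ (a : F) (x : H), β (a • x) = σ a • β x)
    (hauto : ∀ M N : Submodule F H, Module.finrank F M = 2 → Module.finrank F N = 2 →
      (∃ c : H, c ≠ 0 ∧ (N : Set H) = (fun x => c * x) '' (M : Set H)) →
      ∃ c' : H, c' ≠ 0 ∧ ⇑β '' (N : Set H) = (fun x => c' * x) '' (⇑β '' (M : Set H)))
    (hfix : ∃ L : Submodule F H, Module.finrank F L = 2 ∧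
      ∀ c : H, c ≠ 0 →
        ⇑β '' ((fun x => c * x) '' (L : Set H)) = (fun x => c * x) '' (L : Set H)) :
    ∀ M : Submodule F H, Module.finrank F M = 2 →
      ∃ c : H, c ≠ 0 ∧ ⇑β '' (M : Set H) = (fun x => c * x) '' (M : Set H) := by
  obtain ⟨L, hL, hfix⟩ := hfix
  have hFD : Module.Finite F L := Module.finite_of_finrank_pos (by omega)
  let b := Module.finBasisOfFinrankEq F L hL
  obtain ⟨e, he⟩ : ∃ e : H, e = (b 0 : H) := ⟨_, rfl⟩
  obtain ⟨f, hf⟩ : ∃ f : H, f = (b 1 : H) := ⟨_, rfl⟩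
  have he0 : e ≠ 0 := by
    rw [he]
    intro h
    exact b.ne_zero 0 (Subtype.ext h)
  have heL : e ∈ L := he ▸ (b 0).2
  have hfL : f ∈ L := hf ▸ (b 1).2
  have hspan : ∀ x ∈ L, ∃ a c : F, x = algebraMap F H a * e + algebraMap F H c * f := by
    intro x hx
    have h := b.sum_repr ⟨x, hx⟩
    rw [Fin.sum_univ_two] at h
    have h' := congrArg (Subtype.val) h
    refine ⟨b.repr ⟨x, hx⟩ 0, b.repr ⟨x, hx⟩ 1, ?_⟩
    rw [he, hf, ← Algebra.smul_def, ← Algebra.smul_def]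
    simpa using h'.symm
  obtain ⟨t, ht⟩ : ∃ t : H, t = f / e := ⟨_, rfl⟩
  have hft : f = t * e := by rw [ht]; field_simp
  obtain ⟨s, hs⟩ := hsq t
  obtain ⟨P, hP⟩ : ∃ P : H → Prop, ∀ k, P k ↔ ∃ a c : F, k = algebraMap F H a + algebraMap F H c * t :=
    ⟨_, fun _ => Iff.rfl⟩
  have hPF : ∀ a : F, P (algebraMap F H a) := fun a => (hP _).2 ⟨a, 0, by simp⟩
  have hPsub : ∀ x y, P x → P y → P (x - y) := by
    intro x y hx hy
    obtain ⟨a, c, rfl⟩ := (hP _).1 hx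
    obtain ⟨a', c', rfl⟩ := (hP _).1 hy
    exact (hP _).2 ⟨a - a', c - c', by simp only [map_sub]; ring⟩
  have hPmul : ∀ x y, P x → P y → P (x * y) := by
    intro x y hx hy
    obtain ⟨a, c, rfl⟩ := (hP _).1 hx
    obtain ⟨a', c', rfl⟩ := (hP _).1 hy
    refine (hP _).2 ⟨a * a' + c * c' * s, a * c' + c * a', ?_⟩
    simp only [map_add, map_mul]
    rw [← hs]; ring
  have hPinv : ∀ x, P x → P x⁻¹ := by
    intro x hx
    obtain ⟨q, hq⟩ := hsq x
    have : x⁻¹ = x * algebraMap F H q⁻¹ := by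
      rw [map_inv₀, ← hq]
      by_cases h : x = 0
      · simp [h]
      · field_simp
    rw [this]
    exact hPmul _ _ hx (hPF _)
  have hPdiv : ∀ x y, P x → P y → P (x / y) := by
    intro x y hx hy
    rw [div_eq_mul_inv]
    exact hPmul _ _ hx (hPinv _ hy)
  have hPL : ∀ k, P k → k * e ∈ L := by
    intro k hk
    obtain ⟨a, c, rfl⟩ := (hP _).1 hk
    have : (algebraMap F H a + algebraMap F H c * t) * e = a • e + c • f := by
      rw [Algebra.smul_def, Algebra.smul_def, hft]; ring
    rw [this]
    exact L.add_mem (L.smul_mem _ heL) (L.smul_mem _ hfL)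
  have hβ : ∀ x, x ≠ 0 → ∃ k, P k ∧ β x = k * x := by
    intro x hx
    have h := hfix (x / e) (div_ne_zero hx he0)
    have hm : β x ∈ ⇑β '' ((fun y => x / e * y) '' (L : Set H)) :=
      ⟨x, ⟨e, heL, by simp only; field_simp⟩, rfl⟩
    rw [h] at hm
    obtain ⟨y, hy, hyx⟩ := hm
    obtain ⟨a, c, rfl⟩ := hspan y hy
    refine ⟨algebraMap F H a + algebraMap F H c * t, (hP _).2 ⟨a, c, rfl⟩, ?_⟩
    rw [← hyx, hft]
    simp only
    field_simp
  have key : ∀ x y l m : H, x ≠ 0 → y ≠ 0 → ¬ P (y / x) → P l → P m →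
      β x = l * x → β y = m * y → l = m := by
    intro x y l m hx hy hxy hl hm h1 h2
    have hne : x + y ≠ 0 := by
      intro h
      apply hxy
      have : y / x = algebraMap F H (-1) := by
        rw [eq_neg_of_add_eq_zero_right h, map_neg, map_one]; field_simp
      rw [this]; exact hPF _
    obtain ⟨n, hn, h3⟩ := hβ _ hne
    rw [map_add, h1, h2] at h3
    have h4 : (l - n) * x = (n - m) * y := by linear_combination h3
    by_cases hnm : n = m
    · subst hnm
      rw [sub_self, zero_mul] at h4
      rcases mul_eq_zero.1 h4 with h | h
      · exact sub_eq_zero.1 h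
      · exact absurd h hx
    · exfalso
      apply hxy
      have hnm' : n - m ≠ 0 := sub_ne_zero.2 hnm
      have : y / x = (l - n) / (n - m) := by
        rw [div_eq_div_iff hx hnm']
        linear_combination -h4
      rw [this]
      exact hPdiv _ _ (hPsub _ _ hl hn) (hPsub _ _ hn hm)
  obtain ⟨w, hw⟩ : ∃ w, ¬ P w := by
    by_contra! hall
    have : L = ⊤ := by
      rw [eq_top_iff]
      intro x _
      have := hPL (x / e) (hall _)
      rwa [div_mul_cancel₀ _ he0] at this
    rw [this, finrank_top, hrank] at hL
    omega
  have hw0 : w ≠ 0 := by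
    rintro rfl
    apply hw
    simpa using hPF 0
  obtain ⟨d, hd, hd1⟩ := hβ 1 one_ne_zero
  obtain ⟨d', hd', hd1'⟩ := hβ w hw0
  have hdd' : d = d' := key 1 w d d' one_ne_zero hw0 (by simpa using hw) hd hd' hd1 hd1'
  have hmain : ∀ x, β x = d * x := by
    intro x
    by_cases hx : x = 0
    · simp [hx]
    obtain ⟨m, hm, hxm⟩ := hβ x hx
    by_cases hPx : P x
    · have : ¬ P (x / w) := by
        intro h
        apply hw
        have := hPdiv _ _ hPx h
        rwa [div_div_cancel₀ hx] at this
      rw [hxm, hdd', key w x d' m hw0 hx this hd' hm hd1' hxm]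
    · rw [hxm, key 1 x d m one_ne_zero hx (by simpa using hPx) hd hm hd1 hxm]
  intro M _
  refine ⟨d, ?_, ?_⟩
  · rintro rfl
    have : β 1 = 0 := by simpa using hmain 1
    exact one_ne_zero ((map_eq_zero_iff β β.injective).1 this)
  · exact Set.image_congr fun x _ => hmain x
end
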